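/- arXiv:2601.13921 — 2 statements merged into one kernel-verified Lean document; each statement's English description precedes it below -/
import Mathlib

section
/- For all integers M, N ≥ 0 with M + N ≥ 1, the homology of the chain complex D_•(M,N) is concentrated in the top homological degree M + N; that is, H_k(D_•(M,N)) = 0 for every k with 1 ≤ k < M + N. (This is the planar bar complex computation underlying the paper's proof that the dioperad of Frobenius structures satisfies the sufficient Koszulness condition, so that the canonical map Ω⋄_prop(Frob) → Lieb to the properad of Lie bialgebras is a quasi-isomorphism.) -/
open Finset

/-- The merge map `Fin (k+1) → Fin k` collapsing the indices `l` and `l+1`. -/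
def mergeMap {k : ℕ} (l : Fin k) : Fin (k + 1) → Fin k := fun i =>
  if h : (i : ℕ) ≤ (l : ℕ) then ⟨i, lt_of_le_of_lt h l.isLt⟩
  else ⟨(i : ℕ) - 1, by have h1 := i.isLt; omega⟩

lemma mergeMap_surjective {k : ℕ} (l : Fin k) : Function.Surjective (mergeMap l) := by
  intro j
  by_cases h : (j : ℕ) ≤ (l : ℕ)
  · refine ⟨⟨(j : ℕ), by omega⟩, ?_⟩
    simp only [mergeMap]
    rw [dif_pos h]
  · refine ⟨⟨(j : ℕ) + 1, by have := j.isLt; omega⟩, ?_⟩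
    simp only [mergeMap]
    rw [dif_neg (by simp; omega)]
    simp

/-- Basis of the degree-`k` term of the planar bar complex `D_•(M,N)` of the twisted
associative algebra associated with the dioperad of Frobenius structures: sequences
`((m_1,n_1),…,(m_k,n_k))` of pairs of nonnegative integers with `m_i + n_i ≥ 1`,
`Σ m_i = M` and `Σ n_i = N`. -/
def DSeq (M N k : ℕ) : Type :=
  { p : Fin k → ℕ × ℕ //
      (∀ i, 1 ≤ (p i).1 + (p i).2) ∧ (∑ i, (p i).1) = M ∧ (∑ i, (p i).2) = N }

/-- Merging the `l`-th and `(l+1)`-st entries of a sequence (adding the pairs). -/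
def mergeD {M N k : ℕ} (p : DSeq M N (k + 1)) (l : Fin k) : DSeq M N k :=
  ⟨fun j => (∑ i ∈ univ.filter (fun i => mergeMap l i = j), (p.1 i).1,
             ∑ i ∈ univ.filter (fun i => mergeMap l i = j), (p.1 i).2),
   ⟨fun j => by
      obtain ⟨i, hi⟩ := mergeMap_surjective l j
      have h1 : 1 ≤ (p.1 i).1 + (p.1 i).2 := p.2.1 i
      have h2 : (p.1 i).1 + (p.1 i).2
          ≤ ∑ i' ∈ univ.filter (fun i' => mergeMap l i' = j), ((p.1 i').1 + (p.1 i').2) :=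
        Finset.single_le_sum (f := fun i' => (p.1 i').1 + (p.1 i').2)
          (fun _ _ => Nat.zero_le _) (by simp [hi])
      rw [Finset.sum_add_distrib] at h2
      simpa using le_trans h1 h2,
    by rw [Finset.sum_fiberwise]; exact p.2.2.1,
    by rw [Finset.sum_fiberwise]; exact p.2.2.2⟩⟩

/-- The differential of the planar bar complex `D_•(M,N)`. -/
noncomputable def dD (M N k : ℕ) : (DSeq M N (k + 1) →₀ ℚ) →ₗ[ℚ] (DSeq M N k →₀ ℚ) :=
  Finsupp.linearCombination ℚ fun p =>
    ∑ l : Fin k, ((-1 : ℚ) ^ (l : ℕ)) • Finsupp.single (mergeD p l) 1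

set_option linter.unusedSimpArgs false

namespace FrobBar

abbrev W := List (ℕ × ℕ)
abbrev V := W →₀ ℚ

/-- prepend a letter -/
noncomputable def cn (a : ℕ × ℕ) : V →ₗ[ℚ] V := Finsupp.lmapDomain ℚ ℚ (List.cons a)

noncomputable def ml (a : ℕ × ℕ) : W → V
  | [] => 0
  | b :: t => Finsupp.single ((a + b) :: t) 1

/-- add to the first letter -/
noncomputable def mg (a : ℕ × ℕ) : V →ₗ[ℚ] V := Finsupp.linearCombination ℚ (ml a)

noncomputable def dl : W → V
  | [] => 0
  | a :: t => ml a t - cn a (dl t)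

/-- the differential on words -/
noncomputable def dd : V →ₗ[ℚ] V := Finsupp.linearCombination ℚ dl

noncomputable def hl : W → V
  | (a + 1, b) :: t => if a = 0 ∧ b = 0 then 0 else Finsupp.single ((1, 0) :: (a, b) :: t) 1
  | (0, n + 2) :: t => Finsupp.single ((0, 1) :: (0, n + 1) :: t) 1
  | (0, 1) :: (a + 1, b) :: t =>
      if a = 0 ∧ b = 0 then 0 else - Finsupp.single ((0, 1) :: (1, 0) :: (a, b) :: t) 1
  | _ => 0

/-- the homotopy on words -/
noncomputable def hh : V →ₗ[ℚ] V := Finsupp.linearCombination ℚ hl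

/-- basis word -/
noncomputable def e (w : W) : V := Finsupp.single w 1

lemma cn_e (a w) : cn a (e w) = e (a :: w) := by simp [cn, e]
lemma mg_nil (a) : mg a (e []) = 0 := by simp [mg, e, ml]
lemma mg_e (a b w) : mg a (e (b :: w)) = e ((a + b) :: w) := by simp [mg, e, ml]
lemma dd_nil : dd (e []) = 0 := by simp [dd, e, dl]
lemma dd_e (a w) : dd (e (a :: w)) = mg a (e w) - cn a (dd (e w)) := by
  simp [dd, mg, e, dl]

lemma ext_e {f g : V →ₗ[ℚ] V} (h : ∀ w, f (e w) = g (e w)) : f = g := by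
  apply Finsupp.lhom_ext'
  intro w
  ext
  simpa [e] using DFunLike.congr_fun (h w) _

lemma mg_cn (a b) (u : V) : mg a (cn b u) = cn (a + b) u := by
  have : mg a ∘ₗ cn b = cn (a + b) := ext_e fun w => by simp [cn_e, mg_e]
  exact DFunLike.congr_fun this u

lemma mg_mg (a b) (u : V) : mg a (mg b u) = mg (a + b) u := by
  have : mg a ∘ₗ mg b = mg (a + b) := ext_e fun w => by
    cases w <;> simp [mg_nil, mg_e, add_assoc]
  exact DFunLike.congr_fun this u

lemma dd_cn (a) (u : V) : dd (cn a u) = mg a u - cn a (dd u) := by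
  have : dd ∘ₗ cn a = mg a - cn a ∘ₗ dd := ext_e fun w => by simp [cn_e, dd_e]
  exact DFunLike.congr_fun this u

lemma dd_mg (a) (u : V) : dd (mg a u) = mg a (dd u) := by
  have : dd ∘ₗ mg a = mg a ∘ₗ dd := ext_e fun w => by
    cases w <;> simp [mg_nil, mg_e, dd_nil, dd_e, mg_mg, mg_cn]
  exact DFunLike.congr_fun this u

lemma dd_dd (u : V) : dd (dd u) = 0 := by
  have : dd ∘ₗ dd = 0 := ext_e fun w => by
    induction w with
    | nil => simp [dd_nil]
    | cons a w ih =>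
      simp only [LinearMap.comp_apply, LinearMap.zero_apply] at ih
      simp [dd_e, dd_cn, dd_mg, ih]
  exact DFunLike.congr_fun this u

lemma hh_x (a b : ℕ) (h : 1 ≤ a + b) (u : V) :
    hh (cn (a + 1, b) u) = cn (1, 0) (cn (a, b) u) := by
  have : hh ∘ₗ cn (a + 1, b) = cn (1, 0) ∘ₗ cn (a, b) := ext_e fun w => by
    simp only [LinearMap.comp_apply, cn_e]
    simp [hh, e, hl, show ¬ (a = 0 ∧ b = 0) by omega]
  exact DFunLike.congr_fun this u

lemma hh_x1 (u : V) : hh (cn (1, 0) u) = 0 := by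
  have : hh ∘ₗ cn (1, 0) = 0 := ext_e fun w => by
    simp only [LinearMap.comp_apply, cn_e]
    simp [hh, e, hl]
  exact DFunLike.congr_fun this u

lemma hh_y (n : ℕ) (u : V) : hh (cn (0, n + 2) u) = cn (0, 1) (cn (0, n + 1) u) := by
  have : hh ∘ₗ cn (0, n + 2) = cn (0, 1) ∘ₗ cn (0, n + 1) := ext_e fun w => by
    simp only [LinearMap.comp_apply, cn_e]
    simp [hh, e, hl]
  exact DFunLike.congr_fun this u

lemma hh_yx (a b : ℕ) (h : 1 ≤ a + b) (u : V) :
    hh (cn (0, 1) (cn (a + 1, b) u)) = - cn (0, 1) (cn (1, 0) (cn (a, b) u)) := by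
  have : hh ∘ₗ cn (0, 1) ∘ₗ cn (a + 1, b) = - (cn (0, 1) ∘ₗ cn (1, 0) ∘ₗ cn (a, b)) :=
    ext_e fun w => by
    simp only [LinearMap.comp_apply, cn_e, LinearMap.neg_apply]
    simp [hh, e, hl, show ¬ (a = 0 ∧ b = 0) by omega]
  exact DFunLike.congr_fun this u

lemma hh_yx1 (u : V) : hh (cn (0, 1) (cn (1, 0) u)) = 0 := by
  have : hh ∘ₗ cn (0, 1) ∘ₗ cn (1, 0) = 0 := ext_e fun w => by
    simp only [LinearMap.comp_apply, cn_e]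
    simp [hh, e, hl]
  exact DFunLike.congr_fun this u

lemma hh_yy (b : ℕ) (u : V) : hh (cn (0, 1) (cn (0, b) u)) = 0 := by
  have : hh ∘ₗ cn (0, 1) ∘ₗ cn (0, b) = 0 := ext_e fun w => by
    simp only [LinearMap.comp_apply, cn_e]
    simp [hh, e, hl]
  exact DFunLike.congr_fun this u

lemma hh_y1 : hh (cn (0, 1) (e [])) = 0 := by
  simp only [cn_e]
  simp [hh, e, hl]

noncomputable def pp : V →ₗ[ℚ] V := LinearMap.id - dd ∘ₗ hh - hh ∘ₗ dd

lemma pp_apply (u : V) : pp u = u - dd (hh u) - hh (dd u) := rfl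

lemma hh_mg_x (a b : ℕ) (h : 1 ≤ a + b) (w : W) :
    hh (mg (a + 1, b) (e w)) = cn (1, 0) (mg (a, b) (e w)) := by
  cases w with
  | nil => simp [mg_nil]
  | cons c t =>
    obtain ⟨c1, c2⟩ := c
    simp only [← cn_e, mg_cn, Prod.mk_add_mk]
    rw [show a + 1 + c1 = (a + c1) + 1 by omega, hh_x _ _ (by omega)]

lemma pp_x (a b : ℕ) (h : 1 ≤ a + b) (w : W) : pp (e ((a + 1, b) :: w)) = 0 := by
  simp only [pp_apply, ← cn_e, dd_cn, map_sub, mg_cn, hh_x _ _ h, hh_mg_x _ _ h, Prod.mk_add_mk,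
    zero_add, add_comm 1]
  abel

lemma pp_x1 (a b : ℕ) (h : 1 ≤ a + b) (w : W) : pp (e ((1, 0) :: (a, b) :: w)) = 0 := by
  simp only [pp_apply, ← cn_e, dd_cn, map_sub, mg_cn, hh_x1, Prod.mk_add_mk,
    zero_add, add_comm 1, hh_x _ _ h, map_zero]
  abel

lemma pp_C (a b : ℕ) (h : 1 ≤ a + b) (w : W) : pp (e ((0, 1) :: (a + 1, b) :: w)) =
    e ((1, 1) :: (a, b) :: w) - e ((1, 0) :: (a, b + 1) :: w) := by
  have key : hh (cn (0, 1) (mg (a + 1, b) (e w))) = - cn (0, 1) (cn (1, 0) (mg (a, b) (e w))) := by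
    cases w with
    | nil => simp [mg_nil]
    | cons c t =>
      obtain ⟨c1, c2⟩ := c
      simp only [← cn_e, mg_cn, Prod.mk_add_mk]
      rw [show a + 1 + c1 = (a + c1) + 1 by omega, hh_yx _ _ (by omega)]
  simp only [pp_apply, ← cn_e, dd_cn, map_sub, map_neg, mg_cn, hh_yx _ _ h, Prod.mk_add_mk,
    zero_add, add_zero, key, add_comm 1, hh_x _ (b + 1) (by omega : 1 ≤ a + (b + 1))]
  abel

lemma pp_D (c : ℕ × ℕ) (h : 1 ≤ c.1 + c.2) (w : W) : pp (e ((0, 1) :: (1, 0) :: c :: w)) =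
    - e ((1, 0) :: (0, 1) :: c :: w) := by
  obtain ⟨a, b⟩ := c
  simp only at h
  have := fun u => hh_x 0 1 (by omega) u
  simp only [zero_add] at this
  simp only [pp_apply, ← cn_e, dd_cn, map_sub, map_neg, mg_cn, hh_yx1, Prod.mk_add_mk,
    zero_add, add_zero, this, map_zero, add_comm 1 a, hh_yx _ _ h]
  abel

lemma pp_By0 (b : ℕ) : pp (e [(0, 1), (0, b + 1)]) = 0 := by
  simp only [pp_apply, ← cn_e, dd_cn, map_sub, map_neg, mg_cn, hh_yy, Prod.mk_add_mk,
    zero_add, add_zero, map_zero, mg_nil, dd_nil]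
  rw [show 1 + (b + 1) = b + 2 by omega, hh_y]
  abel

lemma pp_Byy (b c : ℕ) (w : W) : pp (e ((0, 1) :: (0, b + 1) :: (0, c) :: w)) = 0 := by
  simp only [pp_apply, ← cn_e, dd_cn, map_sub, map_neg, mg_cn, hh_yy, Prod.mk_add_mk,
    zero_add, add_zero, map_zero]
  rw [show 1 + (b + 1) = b + 2 by omega, hh_y]
  abel

lemma pp_Byx (b a c : ℕ) (w : W) : pp (e ((0, 1) :: (0, b + 1) :: (a + 1, c) :: w)) =
    - e ((0, 1) :: (1, 0) :: (a, b + 1 + c) :: w) := by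
  simp only [pp_apply, ← cn_e, dd_cn, map_sub, map_neg, mg_cn, hh_yy, Prod.mk_add_mk,
    zero_add, add_zero, map_zero]
  rw [show 1 + (b + 1) = b + 2 by omega, hh_y, hh_yx _ _ (by omega)]
  abel

lemma pp_Ay0 (n : ℕ) : pp (e [(0, n + 2)]) = 0 := by
  simp only [pp_apply, ← cn_e, dd_cn, map_sub, map_neg, mg_cn, hh_y, Prod.mk_add_mk,
    zero_add, add_zero, map_zero, mg_nil, dd_nil]
  rw [show 1 + (n + 1) = n + 2 by omega]
  abel

lemma pp_Ayy (n c : ℕ) (w : W) : pp (e ((0, n + 2) :: (0, c) :: w)) = 0 := by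
  simp only [pp_apply, ← cn_e, dd_cn, map_sub, map_neg, mg_cn, hh_y, Prod.mk_add_mk,
    zero_add, add_zero, map_zero]
  rw [show 1 + (n + 1) = n + 2 by omega, show n + 2 + c = (n + c) + 2 by omega, hh_y,
    show n + c + 1 = n + 1 + c by omega]
  abel

lemma pp_Ayx (n a c : ℕ) (w : W) : pp (e ((0, n + 2) :: (a + 1, c) :: w)) =
    e ((0, 1) :: (a + 1, n + 1 + c) :: w) - e ((1, 0) :: (a, n + 2 + c) :: w) := by
  simp only [pp_apply, ← cn_e, dd_cn, map_sub, map_neg, mg_cn, hh_y, Prod.mk_add_mk,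
    zero_add, add_zero, map_zero]
  rw [show 1 + (n + 1) = n + 2 by omega, hh_x _ _ (by omega)]
  abel

lemma pp2_C (a b : ℕ) (h : 1 ≤ a + b) (w : W) : pp (pp (e ((0, 1) :: (a + 1, b) :: w))) = 0 := by
  rw [pp_C a b h, map_sub, pp_x 0 1 (by omega), pp_x1 _ _ (by omega), sub_zero]

lemma pp2_D (c : ℕ × ℕ) (h : 1 ≤ c.1 + c.2) (w : W) :
    pp (pp (e ((0, 1) :: (1, 0) :: c :: w))) = 0 := by
  rw [pp_D c h, map_neg, pp_x1 _ _ (by omega), neg_zero]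

lemma pp3 (w : W) (hw : ∀ a ∈ w, 1 ≤ a.1 + a.2) (h1 : 1 ≤ w.length)
    (h2 : w.length < w.sum.1 + w.sum.2) : pp (pp (pp (e w))) = 0 := by
  match w with
  | [] => simp at h1
  | (a + 1, b) :: t =>
    by_cases hab : 1 ≤ a + b
    · rw [pp_x _ _ hab, map_zero, map_zero]
    · obtain ⟨rfl, rfl⟩ : a = 0 ∧ b = 0 := by omega
      match t with
      | [] => simp at h2
      | (c1, c2) :: t =>
        have := hw (c1, c2) (by simp)
        rw [zero_add, pp_x1 _ _ this, map_zero, map_zero]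
  | (0, 0) :: t => simpa using hw (0, 0) (by simp)
  | (0, n + 2) :: [] => rw [pp_Ay0, map_zero, map_zero]
  | (0, n + 2) :: (0, c) :: t => rw [pp_Ayy, map_zero, map_zero]
  | (0, n + 2) :: (a + 1, c) :: t =>
    rw [pp_Ayx, map_sub, map_sub, pp2_C _ _ (by omega), pp_x1 _ _ (by omega), map_zero, sub_zero]
  | (0, 1) :: [] => simp at h2
  | (0, 1) :: (0, 0) :: t => simpa using hw (0, 0) (by simp)
  | (0, 1) :: (0, b + 1) :: [] => rw [pp_By0, map_zero, map_zero]
  | (0, 1) :: (0, b + 1) :: (0, c) :: t => rw [pp_Byy, map_zero, map_zero]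
  | (0, 1) :: (0, b + 1) :: (a + 1, c) :: t =>
    rw [pp_Byx, map_neg, map_neg, pp2_D _ (by simp; omega), neg_zero]
  | (0, 1) :: (a + 1, b) :: t =>
    by_cases hab : 1 ≤ a + b
    · rw [pp2_C _ _ hab, map_zero]
    · obtain ⟨rfl, rfl⟩ : a = 0 ∧ b = 0 := by omega
      match t with
      | [] => simp at h2
      | c :: t =>
        rw [zero_add, pp2_D _ (hw c (by simp)), map_zero]

/-! transfer -/

def Good (M N k : ℕ) (w : W) : Prop :=
  (∀ a ∈ w, 1 ≤ a.1 + a.2) ∧ w.length = k ∧ w.sum = (M, N)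

def toW {M N k : ℕ} (p : DSeq M N k) : W := List.ofFn p.1

lemma toW_inj {M N k : ℕ} : Function.Injective (toW : DSeq M N k → W) := by
  intro p q h
  exact Subtype.ext (List.ofFn_injective h)

lemma sum_pair {k : ℕ} (p : Fin k → ℕ × ℕ) : (∑ i, p i) = (∑ i, (p i).1, ∑ i, (p i).2) := by
  ext <;> simp [Prod.fst_sum, Prod.snd_sum]

lemma toW_good {M N k : ℕ} (p : DSeq M N k) : Good M N k (toW p) := by
  refine ⟨?_, by simp [toW], ?_⟩
  · intro a ha
    simp only [toW, List.mem_ofFn] at ha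
    obtain ⟨i, rfl⟩ := ha
    exact p.2.1 i
  · rw [toW, List.sum_ofFn, sum_pair, p.2.2.1, p.2.2.2]

lemma good_toW {M N k : ℕ} {w : W} (h : Good M N k w) : ∃ p : DSeq M N k, toW p = w := by
  obtain ⟨h1, rfl, h3⟩ := h
  have h4 : (∑ i, w.get i) = (M, N) := by rw [← List.sum_ofFn, List.ofFn_get, h3]
  rw [sum_pair, Prod.mk.injEq] at h4
  exact ⟨⟨w.get, fun i => h1 _ (List.get_mem _ _), h4.1, h4.2⟩, List.ofFn_get w⟩

noncomputable def emb (M N k : ℕ) : (DSeq M N k →₀ ℚ) →ₗ[ℚ] V := Finsupp.lmapDomain ℚ ℚ toW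

lemma emb_inj (M N k : ℕ) : Function.Injective (emb M N k) :=
  Finsupp.mapDomain_injective toW_inj

lemma emb_single {M N k : ℕ} (p : DSeq M N k) : emb M N k (Finsupp.single p 1) = e (toW p) := by
  simp [emb, e]

def mf {k : ℕ} (p : Fin (k + 1) → ℕ × ℕ) (l : Fin k) : Fin k → ℕ × ℕ :=
  fun j => ∑ i, if mergeMap l i = j then p i else 0

lemma mergeD_val {M N k : ℕ} (p : DSeq M N (k + 1)) (l : Fin k) : (mergeD p l).1 = mf p.1 l := by
  funext j
  simp only [mergeD, mf, ← Finset.sum_filter]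
  ext <;> simp [Prod.fst_sum, Prod.snd_sum]

lemma mm_zero_zero {k : ℕ} : mergeMap (0 : Fin (k + 1)) 0 = 0 := by
  ext; simp [mergeMap]
lemma mm_zero_succ {k : ℕ} (i : Fin (k + 1)) : mergeMap (0 : Fin (k + 1)) i.succ = i := by
  ext; simp [mergeMap]
lemma mm_succ_zero {k : ℕ} (l : Fin k) : mergeMap l.succ 0 = 0 := by
  ext; simp [mergeMap]
lemma mm_succ_succ {k : ℕ} (l : Fin k) (i : Fin (k + 1)) :
    mergeMap l.succ i.succ = (mergeMap l i).succ := by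
  ext
  simp only [mergeMap, Fin.val_succ]
  split_ifs <;> simp <;> omega

lemma mf_zero {k : ℕ} (p : Fin (k + 2) → ℕ × ℕ) :
    List.ofFn (mf p 0) = (p 0 + p 1) :: List.ofFn (fun i : Fin k => p i.succ.succ) := by
  rw [List.ofFn_succ]
  congr 1
  · simp [mf, Fin.sum_univ_succ (n := k + 1), mm_zero_zero, mm_zero_succ]
  · congr 1
    funext i
    simp [mf, Fin.sum_univ_succ (n := k + 1), mm_zero_zero, mm_zero_succ, (Fin.succ_ne_zero i).symm]

lemma mf_succ {k : ℕ} (p : Fin (k + 2) → ℕ × ℕ) (l : Fin k) :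
    List.ofFn (mf p l.succ) = p 0 :: List.ofFn (mf (fun i => p i.succ) l) := by
  rw [List.ofFn_succ]
  congr 1
  · simp [mf, Fin.sum_univ_succ (n := k + 1), mm_succ_zero, mm_succ_succ]
  · congr 1
    funext i
    simp [mf, Fin.sum_univ_succ (n := k + 1), mm_succ_zero, mm_succ_succ, (Fin.succ_ne_zero i).symm]

lemma dd_ofFn : ∀ {k : ℕ} (p : Fin (k + 1) → ℕ × ℕ),
    dd (e (List.ofFn p)) = ∑ l : Fin k, ((-1 : ℚ) ^ (l : ℕ)) • e (List.ofFn (mf p l)) := by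
  intro k
  induction k with
  | zero =>
    intro p
    simp [dd_e, mg_nil, dd_nil]
  | succ k ih =>
    intro p
    rw [List.ofFn_succ, dd_e, ih, Fin.sum_univ_succ, mf_zero, List.ofFn_succ, mg_e]
    simp only [mf_succ, ← cn_e, map_sum, map_smul, Fin.val_succ, pow_succ]
    simp [sub_eq_add_neg]

lemma dd_emb (M N k : ℕ) (x : DSeq M N (k + 1) →₀ ℚ) :
    dd (emb M N (k + 1) x) = emb M N k (dD M N k x) := by
  have : dd ∘ₗ emb M N (k + 1) = emb M N k ∘ₗ dD M N k := by
    apply Finsupp.lhom_ext'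
    intro p
    apply LinearMap.ext_ring
    simp only [LinearMap.comp_apply, Finsupp.lsingle_apply, emb_single]
    rw [toW, dd_ofFn]
    simp only [dD, Finsupp.linearCombination_single, one_smul, map_sum, map_smul, emb_single, toW,
      mergeD_val]
  exact DFunLike.congr_fun this x

lemma hh_e_mem {M N k : ℕ} (w : W) (hw : Good M N k w) :
    hh (e w) ∈ LinearMap.range (emb M N (k + 1)) := by
  have key : ∀ w', Good M N (k + 1) w' → e w' ∈ LinearMap.range (emb M N (k + 1)) := by
    intro w' h
    obtain ⟨p, rfl⟩ := good_toW h
    exact ⟨_, emb_single p⟩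
  obtain ⟨h1, h2, h3⟩ := hw
  have hE : hh (e w) = hl w := by simp [hh, e]
  rw [hE]
  unfold hl
  split
  · split_ifs with h
    · exact zero_mem _
    · apply key
      simp only [Good, List.mem_cons, forall_eq_or_imp, List.length_cons, List.sum_cons] at h1 h2 h3 ⊢
      simp only [Prod.ext_iff (y := (M, N)), Prod.fst_add, Prod.snd_add] at h1 h2 h3 ⊢
      refine ⟨⟨by omega, by omega, h1.2⟩, by omega, by omega, by omega⟩
  · apply key
    simp only [Good, List.mem_cons, forall_eq_or_imp, List.length_cons, List.sum_cons] at h1 h2 h3 ⊢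
    simp only [Prod.ext_iff (y := (M, N)), Prod.fst_add, Prod.snd_add] at h1 h2 h3 ⊢
    refine ⟨⟨by omega, by omega, h1.2⟩, by omega, by omega, by omega⟩
  · split_ifs with h
    · exact zero_mem _
    · apply neg_mem
      apply key
      simp only [Good, List.mem_cons, forall_eq_or_imp, List.length_cons, List.sum_cons] at h1 h2 h3 ⊢
      simp only [Prod.ext_iff (y := (M, N)), Prod.fst_add, Prod.snd_add] at h1 h2 h3 ⊢
      refine ⟨⟨by omega, by omega, by omega, h1.2.2⟩, by omega, by omega, by omega⟩
  · exact zero_mem _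

lemma ind {M N k : ℕ} {P : V → Prop} (x : DSeq M N k →₀ ℚ) (h0 : P 0)
    (ha : ∀ u v, P u → P v → P (u + v)) (hs : ∀ (c : ℚ) u, P u → P (c • u))
    (hw : ∀ w, Good M N k w → P (e w)) : P (emb M N k x) := by
  induction x using Finsupp.induction_linear with
  | zero => simpa using h0
  | add f g hf hg => rw [map_add]; exact ha _ _ hf hg
  | single p c =>
    have : Finsupp.single p c = c • Finsupp.single p 1 := by simp
    rw [this, map_smul, emb_single]
    exact hs _ _ (hw _ (toW_good p))

lemma hh_mem {M N k : ℕ} (x : DSeq M N k →₀ ℚ) :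
    hh (emb M N k x) ∈ LinearMap.range (emb M N (k + 1)) := by
  refine ind (P := fun v => hh v ∈ LinearMap.range (emb M N (k + 1))) x ?_ ?_ ?_ ?_
  · simp
  · intro u v hu hv; rw [map_add]; exact add_mem hu hv
  · intro c u hu; rw [map_smul]; exact Submodule.smul_mem _ _ hu
  · exact hh_e_mem

lemma pp3_emb {M N k : ℕ} (hk : k + 1 < M + N) (x : DSeq M N (k + 1) →₀ ℚ) :
    pp (pp (pp (emb M N (k + 1) x))) = 0 := by
  refine ind (P := fun v => pp (pp (pp v)) = 0) x ?_ ?_ ?_ ?_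
  · simp
  · intro u v hu hv; simp only [map_add, hu, hv, add_zero]
  · intro c u hu; simp only [map_smul, hu, smul_zero]
  · rintro w ⟨h1, h2, h3⟩
    exact pp3 w h1 (by omega) (by rw [h2, h3]; exact hk)

/-- One reduction step on cycles. -/
lemma step {M N k : ℕ} (x : DSeq M N (k + 1) →₀ ℚ) (hx : dD M N k x = 0) :
    ∃ (y : DSeq M N (k + 2) →₀ ℚ) (x' : DSeq M N (k + 1) →₀ ℚ),
      dD M N k x' = 0 ∧ x = dD M N (k + 1) y + x' ∧
      emb M N (k + 1) x' = pp (emb M N (k + 1) x) := by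
  obtain ⟨y, hy⟩ := hh_mem x
  have hd : dd (emb M N (k + 1) x) = 0 := by rw [dd_emb, hx, map_zero]
  refine ⟨y, x - dD M N (k + 1) y, ?_, by abel, ?_⟩
  · apply emb_inj
    rw [← dd_emb, map_sub, map_sub, hd, ← dd_emb, dd_dd]
    simp
  · rw [map_sub, ← dd_emb, hy, pp_apply, hd, map_zero, sub_zero]

end FrobBar

theorem frobenius_planar_bar_homology_vanishes (M N k : ℕ) (hMN : 1 ≤ M + N)
    (hk : 1 ≤ k + 1) (hkMN : k + 1 < M + N)
    (x : DSeq M N (k + 1) →₀ ℚ) (hx : dD M N k x = 0) :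
    ∃ y : DSeq M N (k + 2) →₀ ℚ, dD M N (k + 1) y = x := by
  obtain ⟨y1, x1, h1, e1, p1⟩ := FrobBar.step x hx
  obtain ⟨y2, x2, h2, e2, p2⟩ := FrobBar.step x1 h1
  obtain ⟨y3, x3, h3, e3, p3⟩ := FrobBar.step x2 h2
  have hz : x3 = 0 := by
    apply FrobBar.emb_inj
    rw [p3, p2, p1, FrobBar.pp3_emb hkMN, map_zero]
  refine ⟨y1 + y2 + y3, ?_⟩
  rw [map_add, map_add, e1, e2, e3, hz]
  abel
end

section
/- For all integers M ≥ 1 and 0 ≤ N ≤ M, the homology of the chain complex E_•(M,N) is concentrated in the top homological degree M; that is, H_k(E_•(M,N)) = 0 for every k with 1 ≤ k < M. (This is the planar bar complex computation underlying the Koszulness of the properad QLP of quadratic–linear Poisson structures.) -/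
open Finset

/-- Basis of the degree-`k` term of the planar bar complex `E_•(M,N)` of the twisted
associative algebra associated with the Koszul dual of the dioperad `QLP` of
quadratic–linear Poisson structures: sequences `((m_1,n_1),…,(m_k,n_k))` of pairs of
nonnegative integers with `m_i ≥ 1`, `m_i ≥ n_i`, `Σ m_i = M` and `Σ n_i = N`. -/
def ESeq (M N k : ℕ) : Type :=
  { p : Fin k → ℕ × ℕ //
      (∀ i, 1 ≤ (p i).1) ∧ (∀ i, (p i).2 ≤ (p i).1) ∧
      (∑ i, (p i).1) = M ∧ (∑ i, (p i).2) = N }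

/-- Merging the `l`-th and `(l+1)`-st entries of a sequence (adding the pairs). -/
def mergeE {M N k : ℕ} (p : ESeq M N (k + 1)) (l : Fin k) : ESeq M N k :=
  ⟨fun j => (∑ i ∈ univ.filter (fun i => mergeMap l i = j), (p.1 i).1,
             ∑ i ∈ univ.filter (fun i => mergeMap l i = j), (p.1 i).2),
   ⟨fun j => by
      obtain ⟨i, hi⟩ := mergeMap_surjective l j
      exact le_trans (p.2.1 i)
        (Finset.single_le_sum (f := fun i' => (p.1 i').1)
          (fun _ _ => Nat.zero_le _) (Finset.mem_filter.mpr ⟨Finset.mem_univ i, hi⟩)),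
    fun j => Finset.sum_le_sum (fun i _ => p.2.2.1 i),
    by rw [Finset.sum_fiberwise]; exact p.2.2.2.1,
    by rw [Finset.sum_fiberwise]; exact p.2.2.2.2⟩⟩

/-- The differential of the planar bar complex `E_•(M,N)`. -/
noncomputable def dE (M N k : ℕ) : (ESeq M N (k + 1) →₀ ℚ) →ₗ[ℚ] (ESeq M N k →₀ ℚ) :=
  Finsupp.linearCombination ℚ fun p =>
    ∑ l : Fin k, ((-1 : ℚ) ^ (l : ℕ)) • Finsupp.single (mergeE p l) 1


namespace QLPaux

abbrev W := ℕ × ℕ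
abbrev C := List W →₀ ℚ

def valid (w : W) : Prop := 1 ≤ w.1 ∧ w.2 ≤ w.1

def deg (b : Bool) (w : W) : ℕ := if b then w.1 - w.2 else w.2
def ge (b : Bool) : W := if b then (1, 0) else (1, 1)
def sb (b : Bool) (w : W) : W := if b then (w.1 - 1, w.2) else (w.1 - 1, w.2 - 1)

noncomputable def consL (w : W) : C →ₗ[ℚ] C := Finsupp.lmapDomain ℚ ℚ (List.cons w)

noncomputable def mulB (w : W) : List W → C
  | [] => 0
  | x :: t => Finsupp.single ((w + x) :: t) 1

noncomputable def mulL (w : W) : C →ₗ[ℚ] C := Finsupp.linearCombination ℚ (mulB w)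

noncomputable def Db : List W → C
  | [] => 0
  | w :: t => mulB w t - consL w (Db t)

noncomputable def D : C →ₗ[ℚ] C := Finsupp.linearCombination ℚ Db

noncomputable def Hb (b : Bool) : List W → C
  | [] => 0
  | w :: t => if deg b w = 0 then - consL w (Hb b t) else
      if w = ge b then 0 else Finsupp.single (ge b :: sb b w :: t) 1

noncomputable def H (b : Bool) : C →ₗ[ℚ] C := Finsupp.linearCombination ℚ (Hb b)

def r (b : Bool) : List W → ℕ
  | [] => 0
  | w :: t => if deg b w = 0 then r b t + 1 else 0

@[simp] lemma consL_single (w : W) (l : List W) (a : ℚ) :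
    consL w (Finsupp.single l a) = Finsupp.single (w :: l) a := by
  simp [consL, Finsupp.mapDomain_single]
@[simp] lemma mulL_single (w : W) (l : List W) (a : ℚ) :
    mulL w (Finsupp.single l a) = a • mulB w l := by simp [mulL]
@[simp] lemma D_single (l : List W) (a : ℚ) : D (Finsupp.single l a) = a • Db l := by simp [D]
@[simp] lemma H_single (b : Bool) (l : List W) (a : ℚ) :
    H b (Finsupp.single l a) = a • Hb b l := by simp [H]

lemma lin_ext (f g : C →ₗ[ℚ] C) (h : ∀ l, f (Finsupp.single l 1) = g (Finsupp.single l 1))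
    (c : C) : f c = g c := by
  have : f = g := by
    ext l : 2
    simpa using h l
  rw [this]

lemma D_cons (w : W) (c : C) : D (consL w c) = mulL w c - consL w (D c) :=
  lin_ext (D ∘ₗ consL w) (mulL w - consL w ∘ₗ D) (fun l => by simp [Db]) c

lemma mul_mul (w x : W) (c : C) : mulL w (consL x c) = consL (w + x) c :=
  lin_ext (mulL w ∘ₗ consL x) (consL (w + x)) (fun l => by simp [mulB]) c

lemma mul_mulB (w x : W) (l : List W) : mulL w (mulB x l) = mulB (w + x) l := by
  cases l <;> simp [mulB, add_assoc]

lemma D_mul (w : W) (l : List W) : D (mulB w l) = mulL w (Db l) := by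
  cases l with
  | nil => simp [mulB, Db]
  | cons x t =>
    rw [Db, map_sub, mul_mulB, mul_mul, mulB, D_single, one_smul, Db]

lemma D_Db (l : List W) : D (Db l) = 0 := by
  induction l with
  | nil => simp [Db]
  | cons w t ih => simp [Db, D_cons, ih, D_mul]

lemma D_D (c : C) : D (D c) = 0 :=
  lin_ext (D ∘ₗ D) 0 (fun l => by simp [D_Db]) c

lemma H_cons_zero (b : Bool) (w : W) (hw : deg b w = 0) (c : C) :
    H b (consL w c) = - consL w (H b c) :=
  lin_ext (H b ∘ₗ consL w) (-(consL w ∘ₗ H b)) (fun l => by simp [Hb, hw]) c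

lemma deg_ge (b : Bool) : deg b (ge b) = 1 := by cases b <;> simp [deg, ge]

lemma H_cons_ge (b : Bool) (c : C) : H b (consL (ge b) c) = 0 :=
  lin_ext (H b ∘ₗ consL (ge b)) 0 (fun l => by simp [Hb, deg_ge]) c

lemma H_cons_ne (b : Bool) (w : W) (hw : deg b w ≠ 0) (hw' : w ≠ ge b) (c : C) :
    H b (consL w c) = consL (ge b) (consL (sb b w) c) :=
  lin_ext (H b ∘ₗ consL w) (consL (ge b) ∘ₗ consL (sb b w)) (fun l => by simp [Hb, hw, hw']) c

lemma deg_add (b : Bool) (w x : W) (hw : valid w) (hx : valid x) :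
    deg b (w + x) = deg b w + deg b x := by
  obtain ⟨_, _⟩ := hw; obtain ⟨_, _⟩ := hx
  cases b <;> simp [deg]; omega

lemma add_ne_ge (b : Bool) (w x : W) (hw : valid w) (hx : valid x) : w + x ≠ ge b := by
  obtain ⟨_, _⟩ := hw; obtain ⟨_, _⟩ := hx
  intro h
  have := congrArg Prod.fst h
  cases b <;> simp [ge] at this <;> omega

lemma sb_add (b : Bool) (w x : W) (hw : valid w) (hd : deg b w ≠ 0) :
    sb b (w + x) = sb b w + x := by
  obtain ⟨_, _⟩ := hw
  cases b <;> simp [sb, deg] at * <;> ext <;> simp <;> omega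

lemma sb_ge_add (b : Bool) (x : W) : sb b (ge b + x) = x := by
  cases b <;> simp [sb, ge]

lemma ge_add_sb (b : Bool) (w : W) (hw : valid w) (hd : deg b w ≠ 0) :
    ge b + sb b w = w := by
  obtain ⟨_, _⟩ := hw
  cases b <;> simp [sb, ge, deg] at * <;> ext <;> simp <;> omega

lemma valid_ge (b : Bool) : valid (ge b) := by cases b <;> simp [valid, ge]

lemma valid_sb (b : Bool) (w : W) (hw : valid w) (hd : deg b w ≠ 0) (hne : w ≠ ge b) :
    valid (sb b w) := by
  obtain ⟨m, n⟩ := w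
  obtain ⟨_, _⟩ := hw
  cases b <;> simp [sb, ge, deg, valid] at * <;> omega

lemma map_supp (f : C →ₗ[ℚ] C) (S T : Set (List W))
    (h : ∀ l ∈ S, f (Finsupp.single l 1) ∈ Finsupp.supported ℚ ℚ T) (c : C)
    (hc : c ∈ Finsupp.supported ℚ ℚ S) : f c ∈ Finsupp.supported ℚ ℚ T := by
  rw [Finsupp.supported_eq_span_single] at hc
  have : Submodule.span ℚ ((fun i => Finsupp.single i (1 : ℚ)) '' S) ≤
      (Finsupp.supported ℚ ℚ T).comap f := by
    rw [Submodule.span_le]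
    rintro _ ⟨l, hl, rfl⟩
    exact h l hl
  exact this hc

abbrev F (b : Bool) (R : ℕ) : Submodule ℚ C := Finsupp.supported ℚ ℚ {q | r b q < R}

lemma single_F (b : Bool) (R : ℕ) (l : List W) (h : r b l < R) :
    Finsupp.single l (1 : ℚ) ∈ F b R := Finsupp.single_mem_supported ℚ 1 h

lemma cons_F (b : Bool) (w : W) (R : ℕ) (c : C) (hc : c ∈ F b R) : consL w c ∈ F b (R + 1) := by
  refine map_supp _ _ _ ?_ c hc
  intro l hl
  rw [consL_single]
  apply single_F
  simp only [r]
  simp only [Set.mem_ofPred_eq] at hl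
  split_ifs <;> omega

lemma mulB_F (b : Bool) (w : W) (hw : valid w) (l : List W) : mulB w l ∈ F b (r b l + 1) := by
  cases l with
  | nil => simp [mulB]
  | cons x t =>
    apply single_F
    obtain ⟨_, _⟩ := hw
    cases b <;> simp only [r, deg] <;> simp <;> split_ifs <;> omega

lemma F_mono (b : Bool) {R S : ℕ} (h : R ≤ S) : F b R ≤ F b S :=
  Finsupp.supported_mono (fun _ hq => lt_of_lt_of_le hq h)

lemma mul_F (b : Bool) (w : W) (hw : valid w) (R : ℕ) (c : C) (hc : c ∈ F b R) :
    mulL w c ∈ F b R := by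
  refine map_supp _ _ _ ?_ c hc
  intro l hl
  rw [mulL_single, one_smul]
  exact F_mono b hl (mulB_F b w hw l)

lemma Hb_F (b : Bool) (l : List W) : Hb b l ∈ F b (r b l + 1) := by
  induction l with
  | nil => simp [Hb]
  | cons w t ih =>
    by_cases h : deg b w = 0
    · simp only [Hb, r, h, if_true]
      exact Submodule.neg_mem _ (cons_F b w _ _ ih)
    · simp only [Hb, r, h, if_false]
      split_ifs
      · simp
      · apply single_F
        simp [r, deg_ge]

lemma H_F (b : Bool) (R : ℕ) (c : C) (hc : c ∈ F b R) : H b c ∈ F b R := by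
  refine map_supp _ _ _ ?_ c hc
  intro l hl
  rw [H_single, one_smul]
  exact F_mono b hl (Hb_F b l)

def good (b : Bool) : List W → Prop
  | [] => False
  | w :: t => if deg b w = 0 then good b t else (w = ge b → t ≠ [])

lemma htpy (b : Bool) (l : List W) (hv : ∀ w ∈ l, valid w) (hg : good b l) :
    D (Hb b l) + H b (Db l) - Finsupp.single l 1 ∈ F b (r b l) := by
  induction l with
  | nil => exact hg.elim
  | cons w t ih =>
    have hw : valid w := hv w (by simp)
    have hvt : ∀ w ∈ t, valid w := fun x hx => hv x (by simp [hx])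
    by_cases h : deg b w = 0
    · have hg' : good b t := by simpa [good, h] using hg
      have ih' := ih hvt hg'
      have e : D (Hb b (w :: t)) + H b (Db (w :: t)) - Finsupp.single (w :: t) 1
          = consL w (D (Hb b t) + H b (Db t) - Finsupp.single t 1)
            + (H b (mulB w t) - mulL w (Hb b t)) := by
        simp only [Hb, h, if_true, Db, map_neg, map_sub, map_add, D_cons, H_cons_zero b w h,
          consL_single]
        abel
      rw [e]
      simp only [r, h, if_true]
      refine Submodule.add_mem _ (cons_F b w _ _ ih') (Submodule.sub_mem _ ?_ ?_)
      · exact H_F b _ _ (mulB_F b w hw t)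
      · exact mul_F b w hw _ _ (Hb_F b t)
    · suffices e : D (Hb b (w :: t)) + H b (Db (w :: t)) - Finsupp.single (w :: t) 1 = 0 by
        rw [e]; exact Submodule.zero_mem _
      by_cases hge : w = ge b
      · have ht : t ≠ [] := by
          have := hg
          simp only [good, h, if_false] at this
          exact this hge
        obtain ⟨x, t', rfl⟩ := List.exists_cons_of_ne_nil ht
        have hx : valid x := hvt x (by simp)
        have h1 : Hb b (w :: x :: t') = 0 := by simp [Hb, h, hge, deg_ge]
        have h2 : Db (w :: x :: t') = mulB w (x :: t') - consL w (Db (x :: t')) := rfl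
        rw [h1, h2, map_sub]
        subst hge
        rw [H_cons_ge]
        have h3 : deg b (ge b + x) ≠ 0 := by
          rw [deg_add b _ _ hw hx, deg_ge]; omega
        simp [mulB, Hb, h3, add_ne_ge b _ _ hw hx, sb_ge_add]
      · have h1 : Hb b (w :: t) = consL (ge b) (consL (sb b w) (Finsupp.single t 1)) := by
          simp [Hb, h, hge]
        have h2 : H b (mulB w t) = consL (ge b) (mulB (sb b w) t) := by
          cases t with
          | nil => simp [mulB]
          | cons x t' =>
            have hx : valid x := hvt x (by simp)
            have h3 : deg b (w + x) ≠ 0 := by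
              rw [deg_add b _ _ hw hx]; omega
            simp [mulB, Hb, h3, add_ne_ge b _ _ hw hx, sb_add b w x hw h]
        have h4 : mulB (ge b) (sb b w :: t) = Finsupp.single (w :: t) 1 := by
          rw [mulB, ge_add_sb b w hw h]
        simp only [h1, Db, map_sub, h2, h4, D_cons, H_cons_ne b w h hge, mul_mul, ge_add_sb b w hw h,
          mulL_single, D_single, one_smul, consL_single]
        abel

def P (M N k : ℕ) : Set (List W) := {l | l.length = k ∧ (∀ w ∈ l, valid w) ∧ l.sum = (M, N)}

lemma Hb_P (b : Bool) (M N k : ℕ) (l : List W) (hl : l ∈ P M N k) :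
    Hb b l ∈ Finsupp.supported ℚ ℚ (P M N (k + 1)) := by
  induction l generalizing M N k with
  | nil => simp [Hb]
  | cons w t ih =>
    obtain ⟨h1, h2, h3⟩ := hl
    have hw : valid w := h2 w (by simp)
    have hvt : ∀ w ∈ t, valid w := fun x hx => h2 x (by simp [hx])
    simp only [Hb]
    split_ifs with h h'
    · have := ih t.sum.1 t.sum.2 t.length ⟨rfl, hvt, rfl⟩
      refine Submodule.neg_mem _ (map_supp _ _ _ ?_ _ this)
      rintro q ⟨q1, q2, q3⟩
      rw [consL_single]
      refine Finsupp.single_mem_supported ℚ 1 ⟨?_, ?_, ?_⟩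
      · simp [q1, ← h1]
      · simpa [hw] using q2
      · rw [List.sum_cons, q3, ← h3, List.sum_cons]
    · exact Submodule.zero_mem _
    · refine Finsupp.single_mem_supported ℚ 1 ⟨?_, ?_, ?_⟩
      · simp [← h1]
      · intro x hx
        simp only [List.mem_cons] at hx
        rcases hx with rfl | rfl | hx
        · exact valid_ge b
        · exact valid_sb b w hw h h'
        · exact hvt x hx
      · rw [List.sum_cons, List.sum_cons, ← add_assoc, ge_add_sb b w hw h, ← h3, List.sum_cons]

def toL {M N k : ℕ} (p : ESeq M N k) : List W := List.ofFn p.1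

lemma toL_inj {M N k : ℕ} : Function.Injective (toL : ESeq M N k → List W) := by
  intro p q h
  exact Subtype.ext (List.ofFn_injective h)

lemma toL_P {M N k : ℕ} (p : ESeq M N k) : toL p ∈ P M N k := by
  obtain ⟨p, h1, h2, h3, h4⟩ := p
  refine ⟨by simp [toL], ?_, ?_⟩
  · intro w hw
    simp only [toL, List.mem_ofFn] at hw
    obtain ⟨i, rfl⟩ := hw
    exact ⟨h1 i, h2 i⟩
  · simp only [toL, List.sum_ofFn]
    ext
    · rw [Prod.fst_sum]; exact h3
    · rw [Prod.snd_sum]; exact h4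

lemma P_toL {M N k : ℕ} (l : List W) (hl : l ∈ P M N k) : ∃ p : ESeq M N k, toL p = l := by
  obtain ⟨rfl, h2, h3⟩ := hl
  have e : List.ofFn (fun i : Fin l.length => l[i]) = l := by simp
  have hs := h3
  rw [← e, List.sum_ofFn] at hs
  refine ⟨⟨fun i => l[i], fun i => (h2 _ (by simp)).1, fun i => (h2 _ (by simp)).2, ?_, ?_⟩, e⟩
  · have := congrArg Prod.fst hs
    rwa [Prod.fst_sum] at this
  · have := congrArg Prod.snd hs
    rwa [Prod.snd_sum] at this

noncomputable def io (M N k : ℕ) : (ESeq M N k →₀ ℚ) →ₗ[ℚ] C := Finsupp.lmapDomain ℚ ℚ toL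

lemma io_inj (M N k : ℕ) : Function.Injective (io M N k) := Finsupp.mapDomain_injective toL_inj

@[simp] lemma io_single {M N k : ℕ} (p : ESeq M N k) (a : ℚ) :
    io M N k (Finsupp.single p a) = Finsupp.single (toL p) a := by
  simp [io, Finsupp.mapDomain_single]

lemma io_surj (M N k : ℕ) (c : C) (hc : c ∈ Finsupp.supported ℚ ℚ (P M N k)) :
    ∃ y, io M N k y = c := by
  rw [Finsupp.supported_eq_span_single] at hc
  have : Submodule.span ℚ ((fun i => Finsupp.single i (1 : ℚ)) '' (P M N k)) ≤
      LinearMap.range (io M N k) := by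
    rw [Submodule.span_le]
    rintro _ ⟨l, hl, rfl⟩
    obtain ⟨p, rfl⟩ := P_toL l hl
    exact ⟨Finsupp.single p 1, by simp⟩
  exact this hc

/-- merge at the level of functions -/
def mg {k : ℕ} (p : Fin (k + 1) → W) (l : Fin k) : Fin k → W := fun j =>
  if j < l then p j.castSucc else if j = l then p j.castSucc + p j.succ else p j.succ

lemma mergeE_eq {M N k : ℕ} (p : ESeq M N (k + 1)) (l : Fin k) :
    (mergeE p l).1 = mg p.1 l := by
  funext j
  have key : univ.filter (fun i => mergeMap l i = j) =
      if j < l then {j.castSucc} else if j = l then {j.castSucc, j.succ} else {j.succ} := by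
    ext i
    rw [Finset.mem_filter_univ]
    unfold mergeMap
    have hi := i.isLt
    by_cases h : (i : ℕ) ≤ l
    · rw [dif_pos h]
      split_ifs with h1 h2 <;> rw [Fin.lt_def] at h1 <;>
        simp only [mem_singleton, mem_insert, Fin.ext_iff, Fin.val_castSucc, Fin.val_succ] at * <;>
        omega
    · rw [dif_neg h]
      split_ifs with h1 h2 <;> rw [Fin.lt_def] at h1 <;>
        simp only [mem_singleton, mem_insert, Fin.ext_iff, Fin.val_castSucc, Fin.val_succ] at * <;>
        omega
  simp only [mergeE, key, mg]
  have hne : j.castSucc ≠ j.succ := by simp [Fin.ext_iff]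
  split_ifs <;> simp [Finset.sum_pair hne] <;> rfl

lemma mg_zero {k : ℕ} (p : Fin (k + 2) → W) :
    List.ofFn (mg p 0) = (p 0 + p 1) :: List.ofFn (fun i : Fin k => p i.succ.succ) := by
  rw [List.ofFn_succ]
  simp [mg, Fin.succ_ne_zero]

lemma mg_succ {k : ℕ} (p : Fin (k + 2) → W) (l : Fin k) :
    List.ofFn (mg p l.succ) = p 0 :: List.ofFn (mg (fun i => p i.succ) l) := by
  rw [List.ofFn_succ]
  congr 1
  congr 1
  funext i
  simp [mg]

lemma Db_ofFn {k : ℕ} (p : Fin (k + 1) → W) :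
    Db (List.ofFn p) =
      ∑ l : Fin k, ((-1 : ℚ) ^ (l : ℕ)) • Finsupp.single (List.ofFn (mg p l)) 1 := by
  induction k with
  | zero => simp [Db, mulB]
  | succ k ih =>
    rw [List.ofFn_succ, Fin.sum_univ_succ]
    simp only [Db]
    rw [ih, sub_eq_add_neg]
    congr 1
    · rw [mg_zero, List.ofFn_succ]
      simp [mulB]
    · rw [map_sum, ← Finset.sum_neg_distrib]
      refine Finset.sum_congr rfl fun l _ => ?_
      rw [mg_succ, map_smul, consL_single]
      simp [pow_succ]

lemma io_dE (M N k : ℕ) (x : ESeq M N (k + 1) →₀ ℚ) :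
    io M N k (dE M N k x) = D (io M N (k + 1) x) := by
  have : io M N k ∘ₗ dE M N k = D ∘ₗ io M N (k + 1) := by
    ext p : 2
    simp only [LinearMap.comp_apply, Finsupp.lsingle_apply, io_single, D_single, one_smul, dE,
      Finsupp.linearCombination_single, map_sum, map_smul]
    rw [toL, Db_ofFn]
    refine Finset.sum_congr rfl fun l _ => ?_
    rw [toL, mergeE_eq]
  exact LinearMap.congr_fun this x

lemma htpy_lin (b : Bool) (M N k R : ℕ) (hP : ∀ l ∈ P M N k, good b l) (c : C)
    (hc : c ∈ Finsupp.supported ℚ ℚ (P M N k)) (hF : c ∈ F b (R + 1)) :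
    D (H b c) + H b (D c) - c ∈ F b R := by
  have h : c ∈ Finsupp.supported ℚ ℚ (P M N k ∩ {q | r b q < R + 1}) := by
    rw [Finsupp.mem_supported] at *
    exact Set.subset_inter hc hF
  refine map_supp (D ∘ₗ H b + H b ∘ₗ D - LinearMap.id) _ _ ?_ c h
  rintro l ⟨hl, hr⟩
  have := htpy b l hl.2.1 (hP l hl)
  simp only [LinearMap.sub_apply, LinearMap.add_apply, LinearMap.comp_apply, H_single, D_single,
    one_smul, LinearMap.id_apply]
  exact F_mono b (Nat.lt_succ_iff.mp hr) this

lemma io_P (M N k : ℕ) (x : ESeq M N k →₀ ℚ) :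
    io M N k x ∈ Finsupp.supported ℚ ℚ (P M N k) := by
  induction x using Finsupp.induction_linear with
  | zero => simp
  | add f g hf hg => rw [map_add]; exact Submodule.add_mem _ hf hg
  | single p a => rw [io_single]; exact Finsupp.single_mem_supported ℚ a (toL_P p)

lemma exact_of_good (b : Bool) (M N k : ℕ) (hP : ∀ l ∈ P M N (k + 1), good b l) (R : ℕ)
    (x : ESeq M N (k + 1) →₀ ℚ) (hx : dE M N k x = 0) (hR : io M N (k + 1) x ∈ F b R) :
    ∃ y : ESeq M N (k + 2) →₀ ℚ, dE M N (k + 1) y = x := by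
  induction R generalizing x with
  | zero =>
    have : io M N (k + 1) x = 0 := by
      simpa [F] using hR
    refine ⟨0, ?_⟩
    rw [map_zero]
    exact (io_inj _ _ _ (by rw [this, map_zero])).symm
  | succ R ih =>
    have hD : D (io M N (k + 1) x) = 0 := by rw [← io_dE, hx, map_zero]
    obtain ⟨y, hy⟩ := io_surj M N (k + 2) (H b (io M N (k + 1) x)) (by
      refine map_supp _ _ _ ?_ _ (io_P M N (k + 1) x)
      intro l hl
      rw [H_single, one_smul]
      exact Hb_P b M N _ l hl)
    have h1 := htpy_lin b M N (k + 1) R hP _ (io_P M N (k + 1) x) hR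
    rw [hD, map_zero, add_zero, ← hy, ← io_dE, ← map_sub] at h1
    obtain ⟨z, hz⟩ := ih (dE M N (k + 1) y - x) (by
      rw [map_sub, hx, sub_zero]
      apply io_inj
      rw [io_dE, io_dE, D_D, map_zero]) h1
    exact ⟨y - z, by rw [map_sub, hz]; abel⟩

lemma r_le (b : Bool) (l : List W) : r b l ≤ l.length := by
  induction l with
  | nil => simp [r]
  | cons w t ih => simp only [r, List.length_cons]; split_ifs <;> omega

lemma sum_bd (l : List W) (hv : ∀ w ∈ l, valid w) : l.sum.2 ≤ l.sum.1 := by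
  induction l with
  | nil => simp
  | cons w t ih =>
    have := (hv w (by simp)).2
    have := ih (fun x hx => hv x (by simp [hx]))
    simp only [List.sum_cons, Prod.fst_add, Prod.snd_add]
    omega

lemma good_of (b : Bool) (l : List W) (hv : ∀ w ∈ l, valid w) (h : 2 ≤ deg b l.sum) :
    good b l := by
  induction l with
  | nil => cases b <;> simp [deg] at h
  | cons w t ih =>
    have hw := hv w (by simp)
    have hvt : ∀ w ∈ t, valid w := fun x hx => hv x (by simp [hx])
    have hb := sum_bd t hvt
    have hd : deg b (w + t.sum) = deg b w + deg b t.sum := by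
      obtain ⟨_, _⟩ := hw
      cases b <;> simp [deg]; omega
    rw [List.sum_cons, hd] at h
    simp only [good]
    split_ifs with h0
    · exact ih hvt (by omega)
    · rintro rfl rfl
      rw [deg_ge] at h
      cases b <;> simp [deg] at h

lemma main (b : Bool) (M N k : ℕ) (hP : ∀ l ∈ P M N (k + 1), good b l)
    (x : ESeq M N (k + 1) →₀ ℚ) (hx : dE M N k x = 0) :
    ∃ y : ESeq M N (k + 2) →₀ ℚ, dE M N (k + 1) y = x := by
  refine exact_of_good b M N k hP (k + 2) x hx ?_
  refine Finsupp.supported_mono ?_ (io_P M N (k + 1) x)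
  rintro l ⟨hl, -⟩
  have := r_le b l
  simp only [Set.mem_ofPred_eq]
  omega

end QLPaux

/-- For all integers `M ≥ 1` and `0 ≤ N ≤ M`, the homology of the planar bar complex
`E_•(M,N)` underlying the Koszulness of the properad `QLP` of quadratic–linear Poisson
structures is concentrated in the top homological degree `M`: `H_k(E_•(M,N)) = 0`
for every `k` with `1 ≤ k < M`. -/
theorem QLP_planar_bar_homology_vanishes (M N k : ℕ) (hM : 1 ≤ M) (hNM : N ≤ M)
    (hk : 1 ≤ k + 1) (hkM : k + 1 < M)
    (x : ESeq M N (k + 1) →₀ ℚ) (hx : dE M N k x = 0) :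
    ∃ y : ESeq M N (k + 2) →₀ ℚ, dE M N (k + 1) y = x := by
  by_cases h1 : 2 ≤ M - N
  · refine QLPaux.main true M N k (fun l hl => ?_) x hx
    exact QLPaux.good_of true l hl.2.1 (by rw [hl.2.2]; simpa [QLPaux.deg] using h1)
  by_cases h2 : 2 ≤ N
  · refine QLPaux.main false M N k (fun l hl => ?_) x hx
    exact QLPaux.good_of false l hl.2.1 (by rw [hl.2.2]; simpa [QLPaux.deg] using h2)
  obtain rfl : M = 2 := by omega
  obtain rfl : N = 1 := by omega
  obtain rfl : k = 0 := by omega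
  refine QLPaux.main true 2 1 0 (fun l hl => ?_) x hx
  obtain ⟨a, b, c⟩ := hl
  obtain ⟨w, rfl⟩ := List.length_eq_one_iff.mp a
  simp only [List.sum_singleton] at c
  subst c
  simp [QLPaux.good, QLPaux.deg, QLPaux.ge]
end
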